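/- Let 0 < q < 1, let a, c > 0 and b, d ∈ (−1,0], and assume a·b·c·d·q^n ≠ 1 and a·c·q^n ≠ 1 for every n ∈ ℕ. Define α, β, γ, δ by the Askey–Wilson parametrization. Let A be a unital associative ℂ-algebra containing elements 𝖾, 𝖽 with 𝖽𝖾 − q·𝖾𝖽 = 1; set θ = 1/√(1−q), 𝐄 = θ²·1 + θ·𝖾, 𝐃 = θ²·1 + θ·𝖽, and 𝗑 = (𝖾 + 𝖽)/(2θ). Let φ : A → ℂ be ℂ-linear with φ(1) = 1 and with φ((α𝐄 − γ𝐃)·X) = φ(X) and φ(X·(β𝐃 − δ𝐄)) = φ(X) for every X which is a finite product of factors each equal to 𝐃 or 𝐄 (including the empty product 1). Then for all m ≠ n: φ(p_m(𝗑; a, b, c, d | q) · p_n(𝗑; a, b, c, d | q)) = 0, where the Askey–Wilson polynomials are evaluated at the algebra element 𝗑. -/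

import Mathlib

noncomputable section

open scoped BigOperators

/-- The q-Pochhammer symbol `(a;q)_n = ∏_{j=0}^{n-1} (1 - a q^j)`. -/
def qPoch (q a : ℂ) (n : ℕ) : ℂ := ∏ j ∈ Finset.range n, (1 - a * q ^ j)

/-- The `n`-th Askey–Wilson polynomial `p_n(x; a,b,c,d | q)` as a polynomial in `x`. -/
def awPoly (q a b c d : ℂ) (n : ℕ) : Polynomial ℂ :=
  Polynomial.C (a⁻¹ ^ n * qPoch q (a * b) n * qPoch q (a * c) n * qPoch q (a * d) n) *
    ∑ k ∈ Finset.range (n + 1),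
      Polynomial.C (q ^ k * qPoch q (q⁻¹ ^ n) k * qPoch q (a * b * c * d * q ^ ((n : ℤ) - 1)) k /
          (qPoch q q k * qPoch q (a * b) k * qPoch q (a * c) k * qPoch q (a * d) k)) *
        ∏ j ∈ Finset.range k,
          (Polynomial.C (1 + a ^ 2 * q ^ (2 * j)) - Polynomial.C (2 * a * q ^ j) * Polynomial.X)

theorem qPoch_zero (q a : ℂ) : qPoch q a 0 = 1 := by simp [qPoch]

theorem qPoch_succ (q a : ℂ) (n : ℕ) : qPoch q a (n + 1) = qPoch q a n * (1 - a * q ^ n) :=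
  Finset.prod_range_succ _ _

theorem qPoch_add (q a : ℂ) (m n : ℕ) :
    qPoch q a (m + n) = qPoch q a m * qPoch q (a * q ^ m) n := by
  simp only [qPoch, Finset.prod_range_add, pow_add, mul_assoc]

theorem qPoch_succ' (q a : ℂ) (n : ℕ) : qPoch q a (n + 1) = (1 - a) * qPoch q (a * q) n := by
  rw [add_comm, qPoch_add]
  simp [qPoch]

theorem qPoch_ne_zero {q a : ℂ} (h : ∀ n : ℕ, a * q ^ n ≠ 1) (n : ℕ) : qPoch q a n ≠ 0 :=
  Finset.prod_ne_zero_iff.mpr fun j _ => sub_ne_zero.mpr (h j).symm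

theorem qPoch_inv_pow_eq_zero {q : ℂ} (hq : q ≠ 0) (n : ℕ) : qPoch q (q⁻¹ ^ n) (n + 1) = 0 := by
  rw [qPoch_succ, ← mul_pow, inv_mul_cancel₀ hq]
  simp

/-- The terminating `q`-binomial theorem. -/
theorem sum_qPoch_div_mul_pow {q : ℂ} (hq : q ≠ 0) (hq1 : ∀ n : ℕ, q * q ^ n ≠ 1) (z : ℂ) (n : ℕ) :
    ∑ k ∈ Finset.range (n + 1), qPoch q (q⁻¹ ^ n) k / qPoch q q k * z ^ k =
      ∏ i ∈ Finset.range n, (1 - z * q⁻¹ ^ (i + 1)) := by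
  induction n with
  | zero => simp [qPoch_zero]
  | succ n ih =>
    have pascal : ∀ k, qPoch q (q⁻¹ ^ (n + 1)) (k + 1) / qPoch q q (k + 1) =
        qPoch q (q⁻¹ ^ n) (k + 1) / qPoch q q (k + 1) -
          q⁻¹ ^ (n + 1) * (qPoch q (q⁻¹ ^ n) k / qPoch q q k) := by
      intro k
      have h1 := qPoch_ne_zero hq1 k
      have h2 : 1 - q * q ^ k ≠ 0 := sub_ne_zero.mpr (hq1 k).symm
      have h3 : q⁻¹ ^ (n + 1) * q = q⁻¹ ^ n := by
        rw [pow_succ, mul_assoc, inv_mul_cancel₀ hq, mul_one]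
      rw [qPoch_succ' q (q⁻¹ ^ (n + 1)), h3, qPoch_succ q (q⁻¹ ^ n), qPoch_succ q q, ← h3]
      field_simp
      ring
    have top : qPoch q (q⁻¹ ^ n) (n + 1) / qPoch q q (n + 1) * z ^ (n + 1) = 0 := by
      rw [qPoch_inv_pow_eq_zero hq]; simp
    have split := Finset.sum_range_succ'
      (fun k => qPoch q (q⁻¹ ^ n) k / qPoch q q k * z ^ k) (n + 1)
    rw [Finset.sum_range_succ, top, add_zero, ih] at split
    rw [Finset.prod_range_succ, Finset.sum_range_succ']
    simp only [pascal, sub_mul, Finset.sum_sub_distrib]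
    have shift : ∑ k ∈ Finset.range (n + 1),
        q⁻¹ ^ (n + 1) * (qPoch q (q⁻¹ ^ n) k / qPoch q q k) * z ^ (k + 1) =
        q⁻¹ ^ (n + 1) * z * ∏ i ∈ Finset.range n, (1 - z * q⁻¹ ^ (i + 1)) := by
      rw [← ih, Finset.mul_sum]
      exact Finset.sum_congr rfl fun k _ => by ring
    rw [shift]
    simp only [qPoch_zero] at split ⊢
    linear_combination -split

theorem sum_qPoch_mul_eval_eq_zero {q : ℂ} (hq : q ≠ 0) (hq1 : ∀ n : ℕ, q * q ^ n ≠ 1) {n : ℕ}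
    {P : Polynomial ℂ} (hP : P.natDegree < n) :
    ∑ k ∈ Finset.range (n + 1),
      q ^ k * (qPoch q (q⁻¹ ^ n) k / qPoch q q k) * P.eval (q ^ k) = 0 := by
  have monomial_case : ∀ j < n, ∑ k ∈ Finset.range (n + 1),
      qPoch q (q⁻¹ ^ n) k / qPoch q q k * (q ^ (j + 1)) ^ k = 0 := by
    intro j hj
    rw [sum_qPoch_div_mul_pow hq hq1]
    refine Finset.prod_eq_zero (Finset.mem_range.mpr hj) ?_
    rw [← mul_pow, mul_inv_cancel₀ hq]
    simp
  simp only [Polynomial.eval_eq_sum_range' hP, Finset.mul_sum]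
  rw [Finset.sum_comm]
  refine Finset.sum_eq_zero fun j hj => ?_
  rw [← mul_zero (P.coeff j), ← monomial_case j (Finset.mem_range.mp hj), Finset.mul_sum]
  refine Finset.sum_congr rfl fun k _ => ?_
  rw [← pow_mul, ← pow_mul, add_mul, one_mul, pow_add, mul_comm j k]
  ring

/-- The polynomial `(az, a/z; q)_k` in the variable `x = (z + 1/z) / 2`. -/
def awBasis (q a : ℂ) (k : ℕ) : Polynomial ℂ :=
  ∏ j ∈ Finset.range k,
    (Polynomial.C (1 + a ^ 2 * q ^ (2 * j)) - Polynomial.C (2 * a * q ^ j) * Polynomial.X)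

theorem awBasis_zero (q a : ℂ) : awBasis q a 0 = 1 := by simp [awBasis]

theorem awBasis_succ (q a : ℂ) (k : ℕ) : awBasis q a (k + 1) = awBasis q a k *
    (Polynomial.C (1 + a ^ 2 * q ^ (2 * k)) - Polynomial.C (2 * a * q ^ k) * Polynomial.X) :=
  Finset.prod_range_succ _ _

theorem awBasis_succ' (q a : ℂ) (k : ℕ) : awBasis q a (k + 1) =
    (Polynomial.C (1 + a ^ 2) - Polynomial.C (2 * a) * Polynomial.X) * awBasis q (a * q) k := by
  rw [awBasis, Finset.prod_range_succ', mul_comm]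
  congr 1
  · simp
  · refine Finset.prod_congr rfl fun j _ => ?_
    congr 2
    · ring
    · congr 1
      ring

theorem natDegree_awBasis_le (q a : ℂ) (k : ℕ) : (awBasis q a k).natDegree ≤ k := by
  induction k with
  | zero => simp [awBasis_zero]
  | succ k ih =>
    rw [awBasis_succ]
    refine Polynomial.natDegree_mul_le.trans (add_le_add ih ?_)
    compute_degree

theorem natDegree_awPoly_le (q a b c d : ℂ) (n : ℕ) : (awPoly q a b c d n).natDegree ≤ n := by
  refine (Polynomial.natDegree_C_mul_le _ _).trans
    (Polynomial.natDegree_sum_le_of_forall_le _ _ fun k hk => ?_)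
  exact (Polynomial.natDegree_C_mul_le _ _).trans
    ((natDegree_awBasis_le q a k).trans (Finset.mem_range_succ_iff.mp hk))

theorem aeval_mem_of_mem {A : Type*} [Ring A] [Algebra ℂ A] {S : Subalgebra ℂ A} {x : A}
    (hx : x ∈ S) (f : Polynomial ℂ) : Polynomial.aeval x f ∈ S :=
  Algebra.adjoin_le (Set.singleton_subset_iff.mpr hx) (Polynomial.aeval_mem_adjoin_singleton ℂ x)

section Functional

variable {A : Type*} [Ring A] [Algebra ℂ A]

/-- `φ` satisfies the boundary relations of the matrix ansatz, in terms of the rescaled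
`q`-oscillator generators `u` and `v` of a subalgebra `S`. -/
structure IsBoundaryFunctional (S : Subalgebra ℂ A) (u v : A) (a b c d : ℂ) (φ : A →ₗ[ℂ] ℂ) :
    Prop where
  left : ∀ X ∈ S, φ ((u + (c * d) • v - (c + d) • (1 : A)) * X) = 0
  right : ∀ X ∈ S, φ (X * (v + (a * b) • u - (a + b) • (1 : A))) = 0

variable {S : Subalgebra ℂ A} {u v : A} {a b c d q : ℂ} {φ : A →ₗ[ℂ] ℂ}

namespace IsBoundaryFunctional

theorem shift_left (h : IsBoundaryFunctional S u v a b c d φ)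
    (hv : v ∈ S) (huv : v * u = q • (u * v) + (1 - q) • (1 : A)) :
    IsBoundaryFunctional S u v a b (c * q) d (φ ∘ₗ LinearMap.mulLeft ℂ (1 - c • v)) where
  left X hX := by
    have key : (1 - c • v) * (u + (c * q * d) • v - (c * q + d) • (1 : A)) =
        (u + (c * d) • v - (c + d) • (1 : A)) * (1 - (c * q) • v) := by
      simp only [mul_add, add_mul, mul_sub, sub_mul, mul_smul_comm, smul_mul_assoc, huv, mul_one,
        one_mul]
      module
    have := h.left ((1 - (c * q) • v) * X)
      (S.mul_mem (S.sub_mem S.one_mem (S.smul_mem hv _)) hX)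
    simpa only [LinearMap.comp_apply, LinearMap.mulLeft_apply, ← mul_assoc, key] using this
  right X hX := by
    have := h.right ((1 - c • v) * X) (S.mul_mem (S.sub_mem S.one_mem (S.smul_mem hv _)) hX)
    simpa only [LinearMap.comp_apply, LinearMap.mulLeft_apply, mul_assoc] using this

theorem shift_right (h : IsBoundaryFunctional S u v a b c d φ)
    (hu : u ∈ S) (huv : v * u = q • (u * v) + (1 - q) • (1 : A)) :
    IsBoundaryFunctional S u v (a * q) b c d (φ ∘ₗ LinearMap.mulRight ℂ (1 - a • u)) where
  left X hX := by
    have := h.left (X * (1 - a • u)) (S.mul_mem hX (S.sub_mem S.one_mem (S.smul_mem hu _)))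
    simpa only [LinearMap.comp_apply, LinearMap.mulRight_apply, mul_assoc] using this
  right X hX := by
    have key : (v + (a * q * b) • u - (a * q + b) • (1 : A)) * (1 - a • u) =
        (1 - (a * q) • u) * (v + (a * b) • u - (a + b) • (1 : A)) := by
      simp only [mul_add, add_mul, mul_sub, sub_mul, mul_smul_comm, smul_mul_assoc, huv, mul_one,
        one_mul]
      module
    have := h.right (X * (1 - (a * q) • u))
      (S.mul_mem hX (S.sub_mem S.one_mem (S.smul_mem hu _)))
    rwa [LinearMap.comp_apply, LinearMap.mulRight_apply, mul_assoc, key, ← mul_assoc]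

theorem apply_mul_left (h : IsBoundaryFunctional S u v a b c d φ) {X : A} (hX : X ∈ S) :
    φ (((1 + c ^ 2) • (1 : A) - c • (u + v)) * X) = (1 - c * d) * φ ((1 - c • v) * X) := by
  have key : (1 + c ^ 2) • (1 : A) - c • (u + v) =
      (1 - c * d) • (1 - c • v) - c • (u + (c * d) • v - (c + d) • (1 : A)) := by module
  rw [key, sub_mul, smul_mul_assoc, smul_mul_assoc, map_sub, map_smul, map_smul, h.left X hX]
  simp

theorem apply_mul_right (h : IsBoundaryFunctional S u v a b c d φ) {X : A} (hX : X ∈ S) :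
    φ (X * ((1 + a ^ 2) • (1 : A) - a • (u + v))) = (1 - a * b) * φ (X * (1 - a • u)) := by
  have key : (1 + a ^ 2) • (1 : A) - a • (u + v) =
      (1 - a * b) • (1 - a • u) - a • (v + (a * b) • u - (a + b) • (1 : A)) := by module
  rw [key, mul_sub, mul_smul_comm, mul_smul_comm, map_sub, map_smul, map_smul, h.right X hX]
  simp

theorem first_moments (h : IsBoundaryFunctional S u v a b c d φ) :
    φ u + c * d * φ v - (c + d) * φ 1 = 0 ∧ φ v + a * b * φ u - (a + b) * φ 1 = 0 := by
  have h1 := h.left 1 S.one_mem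
  have h2 := h.right 1 S.one_mem
  simp only [mul_one, one_mul, map_sub, map_add, map_smul, smul_eq_mul] at h1 h2
  exact ⟨h1, h2⟩

theorem mass_left (h : IsBoundaryFunctional S u v a b c d φ) :
    φ (1 - c • v) * (1 - a * b * c * d) = φ 1 * ((1 - a * c) * (1 - c * b)) := by
  obtain ⟨h1, h2⟩ := h.first_moments
  rw [map_sub, map_smul, smul_eq_mul]
  linear_combination c * a * b * h1 - c * h2

theorem mass_right (h : IsBoundaryFunctional S u v a b c d φ) :
    φ (1 - a • u) * (1 - a * b * c * d) = φ 1 * ((1 - a * c) * (1 - a * d)) := by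
  obtain ⟨h1, h2⟩ := h.first_moments
  rw [map_sub, map_smul, smul_eq_mul]
  linear_combination a * c * d * h2 - a * h1

theorem apply_aeval_awBasis (h : IsBoundaryFunctional S u v a b c d φ) (hu : u ∈ S)
    (huv : v * u = q • (u * v) + (1 - q) • (1 : A)) {x : A} (hx : x ∈ S)
    (hxuv : (2 : ℂ) • x = u + v) (k : ℕ) :
    φ (Polynomial.aeval x (awBasis q a k)) * qPoch q (a * b * c * d) k =
      φ 1 * (qPoch q (a * b) k * qPoch q (a * d) k * qPoch q (a * c) k) := by
  induction k generalizing a φ with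
  | zero => simp [awBasis_zero, qPoch_zero]
  | succ k ih =>
    have hfac : Polynomial.aeval x
        (Polynomial.C (1 + a ^ 2) - Polynomial.C (2 * a) * Polynomial.X) =
        (1 + a ^ 2) • (1 : A) - a • (u + v) := by
      rw [← hxuv, map_sub, map_mul, Polynomial.aeval_C, Polynomial.aeval_C, Polynomial.aeval_X,
        Algebra.algebraMap_eq_smul_one, Algebra.algebraMap_eq_smul_one, smul_mul_assoc, one_mul,
        smul_smul, mul_comm a 2]
    have hrec := ih (h.shift_right hu huv)
    rw [awBasis_succ', mul_comm (_ - _ : Polynomial ℂ), map_mul, hfac,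
      h.apply_mul_right (aeval_mem_of_mem hx _)]
    have hmass := h.mass_right
    simp only [LinearMap.comp_apply, LinearMap.mulRight_apply, one_mul] at hrec
    simp only [qPoch_succ']
    rw [show a * b * c * d * q = a * q * b * c * d by ring, mul_right_comm a b q,
      mul_right_comm a c q, mul_right_comm a d q]
    linear_combination (1 - a * b) * (1 - a * b * c * d) * hrec +
      (1 - a * b) * (qPoch q (a * q * b) k * qPoch q (a * q * d) k * qPoch q (a * q * c) k) * hmass

/-- The moments of `φ` in the mixed basis, which are ratios of Askey–Wilson total masses. -/
theorem apply_aeval_awBasis_mul (h : IsBoundaryFunctional S u v a b c d φ) (hu : u ∈ S)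
    (hv : v ∈ S) (huv : v * u = q • (u * v) + (1 - q) • (1 : A)) {x : A} (hx : x ∈ S)
    (hxuv : (2 : ℂ) • x = u + v) (k l : ℕ) :
    φ (Polynomial.aeval x (awBasis q c l * awBasis q a k)) * qPoch q (a * b * c * d) (k + l) =
      φ 1 * (qPoch q (a * b) k * qPoch q (a * d) k * qPoch q (c * b) l * qPoch q (c * d) l *
        qPoch q (a * c) (k + l)) := by
  induction l generalizing c φ with
  | zero => simpa [awBasis_zero, qPoch_zero] using h.apply_aeval_awBasis hu huv hx hxuv k
  | succ l ih =>
    have hfac : Polynomial.aeval x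
        (Polynomial.C (1 + c ^ 2) - Polynomial.C (2 * c) * Polynomial.X) =
        (1 + c ^ 2) • (1 : A) - c • (u + v) := by
      rw [← hxuv, map_sub, map_mul, Polynomial.aeval_C, Polynomial.aeval_C, Polynomial.aeval_X,
        Algebra.algebraMap_eq_smul_one, Algebra.algebraMap_eq_smul_one, smul_mul_assoc, one_mul,
        smul_smul, mul_comm c 2]
    have hrec := ih (h.shift_left hv huv)
    rw [awBasis_succ', mul_assoc, map_mul, hfac,
      h.apply_mul_left (aeval_mem_of_mem hx _)]
    have hmass := h.mass_left
    simp only [LinearMap.comp_apply, LinearMap.mulLeft_apply, mul_one] at hrec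
    simp only [← add_assoc, qPoch_succ']
    rw [show a * b * c * d * q = a * b * (c * q) * d by ring, mul_assoc a c q,
      mul_right_comm c b q, mul_right_comm c d q]
    linear_combination (1 - c * d) * (1 - a * b * c * d) * hrec +
      (1 - c * d) * (qPoch q (a * b) k * qPoch q (a * d) k * qPoch q (c * q * b) l *
        qPoch q (c * q * d) l * qPoch q (a * (c * q)) (k + l)) * hmass

theorem apply_aeval_awBasis_mul_awPoly (h : IsBoundaryFunctional S u v a b c d φ) (hu : u ∈ S)
    (hv : v ∈ S) (huv : v * u = q • (u * v) + (1 - q) • (1 : A)) {x : A} (hx : x ∈ S)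
    (hxuv : (2 : ℂ) • x = u + v) (hq : q ≠ 0) (hq1 : ∀ n : ℕ, q * q ^ n ≠ 1)
    (hab : ∀ n : ℕ, a * b * q ^ n ≠ 1) (hac : ∀ n : ℕ, a * c * q ^ n ≠ 1)
    (had : ∀ n : ℕ, a * d * q ^ n ≠ 1) (habcd : ∀ n : ℕ, a * b * c * d * q ^ n ≠ 1)
    {l n : ℕ} (hl : l < n) :
    φ (Polynomial.aeval x (awBasis q c l * awPoly q a b c d n)) = 0 := by
  obtain ⟨r, rfl⟩ : ∃ r, n = l + r + 1 := ⟨n - l - 1, by omega⟩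
  set s := a * b * c * d with hs
  set P : Polynomial ℂ :=
    (∏ j ∈ Finset.range l, (1 - Polynomial.C (a * c * q ^ j) * Polynomial.X)) *
      ∏ j ∈ Finset.range r, (1 - Polynomial.C (s * q ^ l * q ^ j) * Polynomial.X) with hP
  have degree_le : ∀ (f : ℕ → ℂ) (m : ℕ),
      (∏ j ∈ Finset.range m, (1 - Polynomial.C (f j) * Polynomial.X)).natDegree ≤ m := by
    intro f m
    induction m with
    | zero => simp
    | succ m ih =>
      rw [Finset.prod_range_succ]
      refine Polynomial.natDegree_mul_le.trans (add_le_add ih ?_)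
      compute_degree
  have hdeg : P.natDegree < l + r + 1 :=
    Nat.lt_succ_of_le (Polynomial.natDegree_mul_le.trans
      (add_le_add (degree_le _ _) (degree_le _ _)))
  have hsum := sum_qPoch_mul_eval_eq_zero hq hq1 hdeg
  have hterm : ∀ k, φ (Polynomial.aeval x (awBasis q c l * (Polynomial.C
      (q ^ k * qPoch q (q⁻¹ ^ (l + r + 1)) k *
        qPoch q (s * q ^ (((l + r + 1 : ℕ) : ℤ) - 1)) k /
          (qPoch q q k * qPoch q (a * b) k * qPoch q (a * c) k * qPoch q (a * d) k)) *
        awBasis q a k))) =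
      φ 1 * qPoch q (c * b) l * qPoch q (c * d) l / qPoch q s (l + r) *
        (q ^ k * (qPoch q (q⁻¹ ^ (l + r + 1)) k / qPoch q q k) * P.eval (q ^ k)) := by
    intro k
    have hz : q ^ (((l + r + 1 : ℕ) : ℤ) - 1) = q ^ (l + r) := by
      rw [← zpow_natCast]; congr 1; push_cast; ring
    have heval : P.eval (q ^ k) = qPoch q (a * c * q ^ k) l * qPoch q (s * q ^ (k + l)) r := by
      simp only [hP, Polynomial.eval_mul, Polynomial.eval_prod, Polynomial.eval_sub,
        Polynomial.eval_one, Polynomial.eval_C, Polynomial.eval_X, qPoch]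
      congr 1 <;> refine Finset.prod_congr rfl fun j _ => by ring
    have hM := h.apply_aeval_awBasis_mul hu hv huv hx hxuv k l
    have e1 := qPoch_add q (a * c) k l
    have e2 := qPoch_add q s (k + l) r
    have e3 := qPoch_add q s (l + r) k
    rw [show l + r + k = k + l + r by ring, e2] at e3
    have n1 := qPoch_ne_zero hq1 k
    have n2 := qPoch_ne_zero hab k
    have n3 := qPoch_ne_zero hac k
    have n4 := qPoch_ne_zero had k
    have n5 := qPoch_ne_zero habcd (k + l)
    have n6 := qPoch_ne_zero habcd (l + r)
    rw [hz, heval, mul_left_comm, map_mul, Polynomial.aeval_C, Algebra.algebraMap_eq_smul_one,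
      smul_mul_assoc, one_mul, map_smul, smul_eq_mul, eq_div_of_mul_eq n5 hM,
      eq_div_of_mul_eq n6 ((mul_comm _ _).trans e3.symm), e1]
    field_simp
  change φ (Polynomial.aeval x (awBasis q c l * (Polynomial.C _ *
    ∑ k ∈ Finset.range (l + r + 1 + 1), Polynomial.C _ * awBasis q a k))) = 0
  rw [mul_left_comm, map_mul, Polynomial.aeval_C, Algebra.algebraMap_eq_smul_one,
    smul_mul_assoc, one_mul, map_smul, Finset.mul_sum, map_sum, map_sum]
  simp only [← hs]
  rw [Finset.sum_congr rfl fun k _ => hterm k, ← Finset.mul_sum, hsum]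
  simp

theorem apply_aeval_mul_awPoly (h : IsBoundaryFunctional S u v a b c d φ) (hu : u ∈ S)
    (hv : v ∈ S) (huv : v * u = q • (u * v) + (1 - q) • (1 : A)) {x : A} (hx : x ∈ S)
    (hxuv : (2 : ℂ) • x = u + v) (hq : q ≠ 0) (hq1 : ∀ n : ℕ, q * q ^ n ≠ 1) (hc : c ≠ 0)
    (hab : ∀ n : ℕ, a * b * q ^ n ≠ 1) (hac : ∀ n : ℕ, a * c * q ^ n ≠ 1)
    (had : ∀ n : ℕ, a * d * q ^ n ≠ 1) (habcd : ∀ n : ℕ, a * b * c * d * q ^ n ≠ 1)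
    {n : ℕ} {f : Polynomial ℂ} (hf : f.natDegree < n) :
    φ (Polynomial.aeval x (f * awPoly q a b c d n)) = 0 := by
  have mixed : ∀ i l, i + l < n →
      φ (Polynomial.aeval x (Polynomial.X ^ i * awBasis q c l * awPoly q a b c d n)) = 0 := by
    intro i
    induction i with
    | zero =>
      intro l hl
      rw [pow_zero, one_mul]
      exact h.apply_aeval_awBasis_mul_awPoly hu hv huv hx hxuv hq hq1 hab hac had habcd (by omega)
    | succ i ih =>
      intro l hl
      have h1 := ih l (by omega)
      have h2 := ih (l + 1) (by omega)
      have hne : 2 * c * q ^ l ≠ 0 := by simp [hc, hq]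
      have key : Polynomial.X ^ i * awBasis q c (l + 1) * awPoly q a b c d n =
          Polynomial.C (1 + c ^ 2 * q ^ (2 * l)) *
            (Polynomial.X ^ i * awBasis q c l * awPoly q a b c d n) -
          Polynomial.C (2 * c * q ^ l) *
            (Polynomial.X ^ (i + 1) * awBasis q c l * awPoly q a b c d n) := by
        rw [awBasis_succ]; ring
      rw [key, ← Polynomial.smul_eq_C_mul, ← Polynomial.smul_eq_C_mul, map_sub, map_smul, map_smul,
        map_sub, map_smul, map_smul, h1, smul_zero, zero_sub, neg_eq_zero, smul_eq_mul] at h2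
      exact (mul_eq_zero.mp h2).resolve_left hne
  rw [f.as_sum_range_C_mul_X_pow' hf, Finset.sum_mul, map_sum, map_sum]
  refine Finset.sum_eq_zero fun i hi => ?_
  have := mixed i 0 (by simpa using hi)
  rw [awBasis_zero, mul_one] at this
  rw [mul_assoc, ← Polynomial.smul_eq_C_mul, map_smul, map_smul, this, smul_zero]

end IsBoundaryFunctional

end Functional

theorem eq_zero_of_mem_adjoin_of_list_prod {A : Type*} [Ring A] [Algebra ℂ A] {s : Set A}
    {ψ : A →ₗ[ℂ] ℂ} (h : ∀ l : List A, (∀ y ∈ l, y ∈ s) → ψ l.prod = 0) {X : A}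
    (hX : X ∈ Algebra.adjoin ℂ s) : ψ X = 0 := by
  rw [← Subalgebra.mem_toSubmodule, Algebra.adjoin_eq_span] at hX
  induction hX using Submodule.span_induction with
  | mem y hy =>
    obtain ⟨l, hl, rfl⟩ := Submonoid.exists_list_of_mem_closure hy
    exact h l hl
  | zero => exact map_zero _
  | add y z _ _ hy hz => rw [map_add, hy, hz, add_zero]
  | smul r y _ hy => rw [map_smul, hy, smul_zero]

theorem stmt5 (q : ℝ) (hq0 : 0 < q) (hq1 : q < 1)
    (a b c d : ℝ) (ha : 0 < a) (hc : 0 < c)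
    (hb1 : -1 < b) (hb0 : b ≤ 0) (hd1 : -1 < d) (hd0 : d ≤ 0)
    (hns : ∀ n : ℕ, a * b * c * d * q ^ n ≠ 1)
    (hac : ∀ n : ℕ, a * c * q ^ n ≠ 1)
    (α β γ δ : ℝ)
    (hα : α = (1 - q) / ((1 + c) * (1 + d)))
    (hβ : β = (1 - q) / ((1 + a) * (1 + b)))
    (hγ : γ = -((1 - q) * c * d) / ((1 + c) * (1 + d)))
    (hδ : δ = -((1 - q) * a * b) / ((1 + a) * (1 + b)))
    (A : Type*) [Ring A] [Algebra ℂ A] (e dd : A)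
    (hde : dd * e - (q : ℂ) • (e * dd) = 1)
    (θ : ℝ) (hθ : θ = 1 / Real.sqrt (1 - q))
    (E D : A)
    (hE : E = ((θ : ℂ) ^ 2) • (1 : A) + (θ : ℂ) • e)
    (hD : D = ((θ : ℂ) ^ 2) • (1 : A) + (θ : ℂ) • dd)
    (x : A) (hx : x = ((2 * (θ : ℂ))⁻¹) • (e + dd))
    (φ : A →ₗ[ℂ] ℂ) (hone : φ 1 = 1)
    (hW : ∀ l : List A, (∀ y ∈ l, y = D ∨ y = E) →
      φ (((α : ℂ) • E - (γ : ℂ) • D) * l.prod) = φ l.prod)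
    (hV : ∀ l : List A, (∀ y ∈ l, y = D ∨ y = E) →
      φ (l.prod * ((β : ℂ) • D - (δ : ℂ) • E)) = φ l.prod) :
    ∀ m n : ℕ, m ≠ n →
      φ (Polynomial.aeval x (awPoly (q : ℂ) (a : ℂ) (b : ℂ) (c : ℂ) (d : ℂ) m) *
          Polynomial.aeval x (awPoly (q : ℂ) (a : ℂ) (b : ℂ) (c : ℂ) (d : ℂ) n)) = 0 := by
  have hq1' : (0 : ℝ) < 1 - q := by linarith
  have hθ0 : θ ≠ 0 := by rw [hθ]; positivity
  have hθ2 : θ ^ 2 * (1 - q) = 1 := by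
    rw [hθ, div_pow, Real.sq_sqrt hq1'.le, one_pow, one_div_mul_cancel hq1'.ne']
  have hθC : (θ : ℂ) ≠ 0 := by exact_mod_cast hθ0
  have hθ2C : (θ : ℂ) ^ 2 * (1 - q) = 1 := by exact_mod_cast hθ2
  set S := Algebra.adjoin ℂ ({D, E} : Set A) with hS
  set u : A := (θ : ℂ)⁻¹ • e with hu
  set v : A := (θ : ℂ)⁻¹ • dd with hv
  have heu : e = (θ : ℂ) • u := by rw [hu, smul_inv_smul₀ hθC]
  have hdv : dd = (θ : ℂ) • v := by rw [hv, smul_inv_smul₀ hθC]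
  have hEu : E = ((θ : ℂ) ^ 2) • ((1 : A) + u) := by rw [hE, heu]; module
  have hDv : D = ((θ : ℂ) ^ 2) • ((1 : A) + v) := by rw [hD, hdv]; module
  have hθsq : (θ : ℂ) ^ 2 ≠ 0 := pow_ne_zero 2 hθC
  have hDS : D ∈ S := Algebra.subset_adjoin (by simp)
  have hES : E ∈ S := Algebra.subset_adjoin (by simp)
  have huS : u ∈ S := by
    have : u = ((θ : ℂ) ^ 2)⁻¹ • E - 1 := by rw [hEu, inv_smul_smul₀ hθsq]; abel
    rw [this]
    exact S.sub_mem (S.smul_mem hES _) S.one_mem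
  have hvS : v ∈ S := by
    have : v = ((θ : ℂ) ^ 2)⁻¹ • D - 1 := by rw [hDv, inv_smul_smul₀ hθsq]; abel
    rw [this]
    exact S.sub_mem (S.smul_mem hDS _) S.one_mem
  have hxuv : (2 : ℂ) • x = u + v := by
    rw [hx, hu, hv, smul_smul, ← smul_add, mul_inv, mul_inv_cancel_left₀ two_ne_zero]
  have hxS : x ∈ S := by
    have : x = (2 : ℂ)⁻¹ • (u + v) := by rw [← hxuv, inv_smul_smul₀ two_ne_zero]
    rw [this]
    exact S.smul_mem (S.add_mem huS hvS) _
  have huv : v * u = (q : ℂ) • (u * v) + (1 - (q : ℂ)) • (1 : A) := by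
    have h1 : (1 - (q : ℂ)) = (θ : ℂ)⁻¹ * (θ : ℂ)⁻¹ := by
      field_simp
      linear_combination hθ2C
    have h2 : dd * e = 1 + (q : ℂ) • (e * dd) := sub_eq_iff_eq_add.mp hde
    rw [h1, hu, hv]
    simp only [smul_mul_assoc, mul_smul_comm, h2]
    module
  have hab0 : (1 + (a : ℂ)) * (1 + b) ≠ 0 := by
    have : (1 + a) * (1 + b) ≠ 0 := by
      have : 0 < 1 + b := by linarith
      positivity
    exact_mod_cast this
  have hcd0 : (1 + (c : ℂ)) * (1 + d) ≠ 0 := by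
    have : (1 + c) * (1 + d) ≠ 0 := by
      have : 0 < 1 + d := by linarith
      positivity
    exact_mod_cast this
  have hWop : (α : ℂ) • E - (γ : ℂ) • D - 1 = ((1 + (c : ℂ)) * (1 + d))⁻¹ •
      (u + ((c : ℂ) * d) • v - ((c : ℂ) + d) • (1 : A)) := by
    have h1 : (α : ℂ) * (θ : ℂ) ^ 2 = ((1 + (c : ℂ)) * (1 + d))⁻¹ := by
      rw [hα]; push_cast
      rw [div_mul_eq_mul_div, mul_comm (1 - (q : ℂ)), hθ2C, one_div]
    have h2 : (γ : ℂ) * (θ : ℂ) ^ 2 = -(((1 + (c : ℂ)) * (1 + d))⁻¹ * (c * d)) := by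
      rw [hγ]; push_cast
      rw [div_mul_eq_mul_div, div_eq_mul_inv]
      linear_combination (-((1 + (c : ℂ)) * (1 + d))⁻¹ * (c * d)) * hθ2C
    have h3 : (1 : A) = (((1 + (c : ℂ)) * (1 + d))⁻¹ * ((1 + (c : ℂ)) * (1 + d))) • (1 : A) := by
      rw [inv_mul_cancel₀ hcd0, one_smul]
    rw [hEu, hDv, smul_smul, smul_smul, h1, h2]
    nth_rewrite 3 [h3]
    module
  have hVop : (β : ℂ) • D - (δ : ℂ) • E - 1 = ((1 + (a : ℂ)) * (1 + b))⁻¹ •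
      (v + ((a : ℂ) * b) • u - ((a : ℂ) + b) • (1 : A)) := by
    have h1 : (β : ℂ) * (θ : ℂ) ^ 2 = ((1 + (a : ℂ)) * (1 + b))⁻¹ := by
      rw [hβ]; push_cast
      rw [div_mul_eq_mul_div, mul_comm (1 - (q : ℂ)), hθ2C, one_div]
    have h2 : (δ : ℂ) * (θ : ℂ) ^ 2 = -(((1 + (a : ℂ)) * (1 + b))⁻¹ * (a * b)) := by
      rw [hδ]; push_cast
      rw [div_mul_eq_mul_div, div_eq_mul_inv]
      linear_combination (-((1 + (a : ℂ)) * (1 + b))⁻¹ * (a * b)) * hθ2C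
    have h3 : (1 : A) = (((1 + (a : ℂ)) * (1 + b))⁻¹ * ((1 + (a : ℂ)) * (1 + b))) • (1 : A) := by
      rw [inv_mul_cancel₀ hab0, one_smul]
    rw [hEu, hDv, smul_smul, smul_smul, h1, h2]
    nth_rewrite 3 [h3]
    module
  have hφ : IsBoundaryFunctional S u v (a : ℂ) b c d φ := by
    constructor
    · intro X hX
      refine eq_zero_of_mem_adjoin_of_list_prod
        (ψ := φ ∘ₗ LinearMap.mulLeft ℂ (u + ((c : ℂ) * d) • v - ((c : ℂ) + d) • (1 : A)))
        (fun l hl => ?_) hX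
      have := sub_eq_zero.mpr (hW l (by simpa using hl))
      rw [← map_sub, ← sub_one_mul, hWop, smul_mul_assoc, map_smul, smul_eq_mul] at this
      exact (mul_eq_zero.mp this).resolve_left (inv_ne_zero hcd0)
    · intro X hX
      refine eq_zero_of_mem_adjoin_of_list_prod
        (ψ := φ ∘ₗ LinearMap.mulRight ℂ (v + ((a : ℂ) * b) • u - ((a : ℂ) + b) • (1 : A)))
        (fun l hl => ?_) hX
      have := sub_eq_zero.mpr (hV l (by simpa using hl))
      rw [← map_sub, ← mul_sub_one, hVop, mul_smul_comm, map_smul, smul_eq_mul] at this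
      exact (mul_eq_zero.mp this).resolve_left (inv_ne_zero hab0)
  have hqC : (q : ℂ) ≠ 0 := by exact_mod_cast hq0.ne'
  have hqC1 : ∀ n : ℕ, (q : ℂ) * (q : ℂ) ^ n ≠ 1 := by
    intro n
    rw [← pow_succ']
    exact_mod_cast (pow_lt_one₀ hq0.le hq1 n.succ_ne_zero).ne
  have hnonpos : ∀ t : ℝ, t ≤ 0 → ∀ n : ℕ, (a : ℂ) * t * (q : ℂ) ^ n ≠ 1 := by
    intro t ht n
    have : a * t * q ^ n ≤ 0 := mul_nonpos_of_nonpos_of_nonneg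
      (mul_nonpos_of_nonneg_of_nonpos ha.le ht) (pow_nonneg hq0.le n)
    have : a * t * q ^ n ≠ 1 := by linarith
    exact_mod_cast this
  have hlt : ∀ m n : ℕ, m < n →
      φ (Polynomial.aeval x (awPoly (q : ℂ) (a : ℂ) (b : ℂ) (c : ℂ) (d : ℂ) m *
        awPoly (q : ℂ) (a : ℂ) (b : ℂ) (c : ℂ) (d : ℂ) n)) = 0 := fun m n hmn =>
    hφ.apply_aeval_mul_awPoly huS hvS huv hxS hxuv hqC hqC1 (by exact_mod_cast hc.ne')
      (hnonpos b hb0) (fun n => by exact_mod_cast hac n) (hnonpos d hd0)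
      (fun n => by exact_mod_cast hns n) ((natDegree_awPoly_le _ _ _ _ _ m).trans_lt hmn)
  intro m n hmn
  rw [← map_mul]
  rcases lt_or_gt_of_ne hmn with hmn | hmn
  · exact hlt m n hmn
  · rw [mul_comm]
    exact hlt n m hmn


end
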